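/- Let C ⊆ GF(2)^k be a linear code of dimension r ≥ 1 with r ≤ k, and let G be an r×k generator matrix of C with columns g_1,…,g_k ∈ GF(2)^r. There exists a cyclic binary sequence x of length n = 2^r − 1 whose n length-k cyclic windows are exactly the nonzero codewords of C (each nonzero codeword occurring as a window exactly once) if and only if: (i) every r contiguous columns g_{j+1},…,g_{j+r} (for 0 ≤ j ≤ k−r) are linearly independent over GF(2), and (ii) there exists a primitive polynomial a(z) = z^r + Σ_{i=0}^{r−1} a_i z^i of degree r over GF(2) such that g_{r+j} = Σ_{i=0}^{r−1} a_i g_{i+j} for all j ∈ {1,…,k−r}. -/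

import Mathlib

/-- Length-`k` cyclic window of the sequence `x` (indexed cyclically by `ZMod n`)
starting at phase `m`: `(x_m, x_{m+1}, …, x_{m+k-1})` with indices modulo `n`. -/
def win {α : Type*} {n : ℕ} (k : ℕ) (x : ZMod n → α) (m : ZMod n) : Fin k → α :=
  fun i => x (m + ((i : ℕ) : ZMod n))

/-- The monic polynomial `z^r + ∑_{i=0}^{r-1} a_i z^i` over GF(2). -/
noncomputable def lfsrPoly {r : ℕ} (a : Fin r → ZMod 2) : Polynomial (ZMod 2) :=
  Polynomial.X ^ r + ∑ i : Fin r, Polynomial.C (a i) * Polynomial.X ^ (i : ℕ)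

/-- `a(z) = z^r + ∑_{i=0}^{r-1} a_i z^i` is primitive over GF(2): it is irreducible and
the residue class of `z` in `GF(2)[z]/(a(z))` has multiplicative order `2^r - 1`. -/
def IsPrimitivePoly {r : ℕ} (a : Fin r → ZMod 2) : Prop :=
  Irreducible (lfsrPoly a) ∧ orderOf (AdjoinRoot.root (lfsrPoly a)) = 2 ^ r - 1

/-- The cyclic LFSR recursion `x_{r+j} = ∑_{i=0}^{r-1} a_i x_{i+j}` (mod 2),
for all `j`, indices cyclic modulo `n`. -/
def IsLFSR {n r : ℕ} (a : Fin r → ZMod 2) (x : ZMod n → ZMod 2) : Prop :=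
  ∀ j : ZMod n, x (j + (r : ZMod n)) = ∑ i : Fin r, a i * x (j + ((i : ℕ) : ZMod n))


open Polynomial

section LfsrPoly

variable {r : ℕ} (a : Fin r → ZMod 2)

theorem degree_sum_C_mul_X_pow_lt (c : Fin r → ZMod 2) :
    (∑ i : Fin r, C (c i) * X ^ (i : ℕ) : (ZMod 2)[X]).degree < r :=
  degree_sum_fin_lt c

theorem lfsrPoly_monic : (lfsrPoly a).Monic :=
  monic_X_pow_add (degree_sum_C_mul_X_pow_lt a)

theorem lfsrPoly_ne_zero : lfsrPoly a ≠ 0 :=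
  (lfsrPoly_monic a).ne_zero

theorem natDegree_lfsrPoly : (lfsrPoly a).natDegree = r := by
  refine natDegree_eq_of_degree_eq_some ?_
  rw [lfsrPoly, degree_add_eq_left_of_degree_lt, degree_X_pow]
  rw [degree_X_pow]
  exact degree_sum_C_mul_X_pow_lt a

theorem lfsrPoly_coeff {f : (ZMod 2)[X]} (hf : f.Monic) (hr : f.natDegree = r) :
    lfsrPoly (fun i : Fin r => f.coeff i) = f := by
  subst hr
  conv_rhs => rw [hf.as_sum, ← Fin.sum_univ_eq_sum_range (fun i => C (f.coeff i) * X ^ i)]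
  rfl

theorem card_adjoinRoot {p : (ZMod 2)[X]} (hp : p ≠ 0) :
    Finite (AdjoinRoot p) ∧ Nat.card (AdjoinRoot p) = 2 ^ p.natDegree := by
  have : Module.Finite (ZMod 2) (AdjoinRoot p) := (AdjoinRoot.powerBasis hp).finite
  have : Finite (AdjoinRoot p) := Module.finite_of_finite (ZMod 2)
  refine ⟨this, ?_⟩
  rw [Module.natCard_eq_pow_finrank (K := ZMod 2), Nat.card_zmod,
    (AdjoinRoot.powerBasis hp).finrank, AdjoinRoot.powerBasis_dim]

theorem exists_isPrimitivePoly (hr : r ≠ 0) : ∃ a : Fin r → ZMod 2, IsPrimitivePoly a := by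
  let K := GaloisField 2 r
  have : Finite K := inferInstance
  obtain ⟨u, hu⟩ := IsCyclic.exists_generator (α := Kˣ)
  have hint : IsIntegral (ZMod 2) (u : K) := Algebra.IsIntegral.isIntegral _
  have htop : IntermediateField.adjoin (ZMod 2) {(u : K)} = ⊤ := by
    rw [eq_top_iff]
    rintro y -
    rcases eq_or_ne y 0 with rfl | hy
    · exact zero_mem _
    · obtain ⟨z, hz⟩ := hu (Units.mk0 y hy)
      have : y = (u : K) ^ z := by
        rw [← Units.val_zpow_eq_zpow_val]
        exact (congrArg Units.val hz).symm
      rw [this]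
      exact zpow_mem (IntermediateField.mem_adjoin_simple_self _ _) _
  have hdeg : (minpoly (ZMod 2) (u : K)).natDegree = r := by
    rw [(Field.primitive_element_iff_minpoly_natDegree_eq (ZMod 2) (u : K)).1 htop,
      GaloisField.finrank 2 hr]
  refine ⟨fun i => (minpoly (ZMod 2) (u : K)).coeff i, ?_⟩
  rw [IsPrimitivePoly, lfsrPoly_coeff (minpoly.monic hint) hdeg]
  have hirr := minpoly.irreducible hint
  refine ⟨hirr, ?_⟩
  have : Fact (Irreducible (minpoly (ZMod 2) (u : K))) := ⟨hirr⟩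
  let φ : AdjoinRoot (minpoly (ZMod 2) (u : K)) →+* K :=
    AdjoinRoot.lift (algebraMap (ZMod 2) K) (u : K) (minpoly.aeval _ _)
  have hφ : φ (AdjoinRoot.root _) = u := AdjoinRoot.lift_root _
  rw [← orderOf_injective φ.toMonoidHom φ.injective]
  change orderOf (φ _) = _
  rw [hφ, orderOf_units, orderOf_eq_card_of_forall_mem_zpowers hu, Nat.card_units,
    GaloisField.card 2 r hr]

end LfsrPoly

section Shift

variable {n : ℕ}

/-- The cyclic shift operator on sequences over GF(2). -/
def cyclicShift (n : ℕ) : Module.End (ZMod 2) (ZMod n → ZMod 2) :=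
  LinearMap.funLeft (ZMod 2) (ZMod 2) (· + 1)

theorem cyclicShift_pow_apply (m : ℕ) (x : ZMod n → ZMod 2) (j : ZMod n) :
    (cyclicShift n ^ m) x j = x (j + m) := by
  induction m generalizing j with
  | zero => simp
  | succ m ih =>
    rw [pow_succ', Module.End.mul_apply]
    change (cyclicShift n ^ m) x (j + 1) = _
    rw [ih]
    congr 1
    push_cast
    ring

theorem aeval_cyclicShift_sum_apply {r : ℕ} (c : Fin r → ZMod 2) (x : ZMod n → ZMod 2)
    (j : ZMod n) :
    aeval (cyclicShift n) (∑ i : Fin r, C (c i) * X ^ (i : ℕ)) x j =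
      ∑ i : Fin r, c i * x (j + ((i : ℕ) : ZMod n)) := by
  simp [LinearMap.sum_apply, Finset.sum_apply, cyclicShift_pow_apply, ← Algebra.smul_def]

theorem IsLFSR.aeval_lfsrPoly {r : ℕ} {a : Fin r → ZMod 2} {x : ZMod n → ZMod 2}
    (h : IsLFSR a x) : aeval (cyclicShift n) (lfsrPoly a) x = 0 := by
  funext j
  rw [lfsrPoly, map_add, LinearMap.add_apply, Pi.add_apply, aeval_cyclicShift_sum_apply, ← h j]
  simp [cyclicShift_pow_apply, CharTwo.add_self_eq_zero]

/-- The map sending `none` to `0` and the residue `m` to `y ^ m`. -/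
def zeroOrPow {A : Type*} [MonoidWithZero A] (n : ℕ) (y : A) : Option (ZMod n) → A :=
  fun o => o.elim 0 fun m => y ^ m.val

variable {x : ZMod n → ZMod 2}

theorem aeval_cyclicShift_eq_of_mk_eq {p q q' : (ZMod 2)[X]}
    (hp : aeval (cyclicShift n) p x = 0) (h : AdjoinRoot.mk p q = AdjoinRoot.mk p q') :
    aeval (cyclicShift n) q x = aeval (cyclicShift n) q' x := by
  obtain ⟨t, ht⟩ := AdjoinRoot.mk_eq_mk.1 h
  rw [← sub_eq_zero, ← LinearMap.sub_apply, ← map_sub, ht, mul_comm, map_mul,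
    Module.End.mul_apply, hp, map_zero]

theorem root_pow_ne_zero (hx : x ≠ 0) {p : (ZMod 2)[X]}
    (hp : aeval (cyclicShift n) p x = 0) (m : ℕ) : AdjoinRoot.root p ^ m ≠ 0 := by
  intro h
  rw [← AdjoinRoot.mk_X, ← map_pow, ← map_zero (AdjoinRoot.mk p)] at h
  have h' := aeval_cyclicShift_eq_of_mk_eq hp h
  refine hx (funext fun j => ?_)
  simpa [cyclicShift_pow_apply] using congrFun h' (j - m)

theorem natCast_eq_of_root_pow_eq (hinj : Function.Injective fun m j : ZMod n => x (j + m))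
    {p : (ZMod 2)[X]} (hp : aeval (cyclicShift n) p x = 0) {m m' : ℕ}
    (h : AdjoinRoot.root p ^ m = AdjoinRoot.root p ^ m') : (m : ZMod n) = m' := by
  rw [← AdjoinRoot.mk_X, ← map_pow, ← map_pow] at h
  have h' := aeval_cyclicShift_eq_of_mk_eq hp h
  refine hinj (funext fun j => ?_)
  simpa [cyclicShift_pow_apply] using congrFun h' j

theorem zeroOrPow_injective {A : Type*} [MonoidWithZero A] [NeZero n] {y : A}
    (h0 : ∀ m : ℕ, y ^ m ≠ 0) (h : ∀ m m' : ℕ, y ^ m = y ^ m' → (m : ZMod n) = m') :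
    Function.Injective (zeroOrPow n y) := by
  rintro (_ | m) (_ | m') hm
  · rfl
  · exact absurd hm.symm (h0 _)
  · exact absurd hm (h0 _)
  · simpa using h _ _ hm

variable [NeZero n]

theorem zeroOrPow_root_injective (hx : x ≠ 0)
    (hinj : Function.Injective fun m j : ZMod n => x (j + m)) {p : (ZMod 2)[X]}
    (hp : aeval (cyclicShift n) p x = 0) :
    Function.Injective (zeroOrPow n (AdjoinRoot.root p)) :=
  zeroOrPow_injective (root_pow_ne_zero hx hp) fun _ _ => natCast_eq_of_root_pow_eq hinj hp

theorem succ_le_two_pow_natDegree (hx : x ≠ 0)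
    (hinj : Function.Injective fun m j : ZMod n => x (j + m)) {p : (ZMod 2)[X]} (hp0 : p ≠ 0)
    (hp : aeval (cyclicShift n) p x = 0) : n + 1 ≤ 2 ^ p.natDegree := by
  obtain ⟨hfin, hcard⟩ := card_adjoinRoot hp0
  have := Nat.card_le_card_of_injective _ (zeroOrPow_root_injective hx hinj hp)
  rwa [hcard, Finite.card_option, Nat.card_zmod] at this

theorem isPrimitivePoly_of_isLFSR {r : ℕ} (hn : n = 2 ^ r - 1) {a : Fin r → ZMod 2} (hx : x ≠ 0)
    (hinj : Function.Injective fun m j : ZMod n => x (j + m)) (h : IsLFSR a x) :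
    IsPrimitivePoly a := by
  have hp0 := lfsrPoly_ne_zero a
  have hpos : 0 < n := Nat.pos_of_ne_zero (NeZero.ne n)
  have hp := h.aeval_lfsrPoly
  obtain ⟨hfin, hcard⟩ := card_adjoinRoot hp0
  have hbij : Function.Bijective (zeroOrPow n (AdjoinRoot.root (lfsrPoly a))) := by
    rw [Nat.bijective_iff_injective_and_card]
    refine ⟨zeroOrPow_root_injective hx hinj hp, ?_⟩
    rw [hcard, natDegree_lfsrPoly, Finite.card_option, Nat.card_zmod]
    omega
  have hpow : ∀ y : AdjoinRoot (lfsrPoly a), y ≠ 0 →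
      ∃ m < n, y = AdjoinRoot.root (lfsrPoly a) ^ m := by
    intro y hy
    obtain ⟨_ | m, rfl⟩ := hbij.2 y
    · exact absurd rfl hy
    · exact ⟨m.val, m.val_lt, rfl⟩
  have hroot : AdjoinRoot.root (lfsrPoly a) ^ n = 1 := by
    obtain ⟨m, hm, hnm⟩ := hpow _ (root_pow_ne_zero hx hp n)
    have h0 := natCast_eq_of_root_pow_eq hinj hp hnm
    rw [ZMod.natCast_self, eq_comm, ZMod.natCast_eq_zero_iff] at h0
    rw [hnm, Nat.eq_zero_of_dvd_of_lt h0 hm, pow_zero]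
  constructor
  · have : Nontrivial (AdjoinRoot (lfsrPoly a)) := ⟨_, _, root_pow_ne_zero hx hp 0⟩
    have : NoZeroDivisors (AdjoinRoot (lfsrPoly a)) := by
      refine ⟨fun {y z} hyz => ?_⟩
      by_contra! hne
      obtain ⟨i, -, rfl⟩ := hpow y hne.1
      obtain ⟨j, -, rfl⟩ := hpow z hne.2
      rw [← pow_add] at hyz
      exact root_pow_ne_zero hx hp _ hyz
    have hdom : IsDomain ((ZMod 2)[X] ⧸ Ideal.span {lfsrPoly a}) :=
      NoZeroDivisors.to_isDomain (AdjoinRoot (lfsrPoly a))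
    rw [Ideal.Quotient.isDomain_iff_prime, Ideal.span_singleton_prime hp0] at hdom
    exact hdom.irreducible
  · rw [← hn, orderOf_eq_iff hpos]
    refine ⟨hroot, fun m hm hm0 h1 => ?_⟩
    rw [← pow_zero (AdjoinRoot.root (lfsrPoly a))] at h1
    have h0 := natCast_eq_of_root_pow_eq hinj hp h1
    rw [Nat.cast_zero, ZMod.natCast_eq_zero_iff] at h0
    exact hm0.ne' (Nat.eq_zero_of_dvd_of_lt h0 hm)

end Shift

section Recursion

variable {r k : ℕ} (a : Fin r → ZMod 2)

/-- The length-`k` words satisfying the (non-cyclic) linear recursion with coefficients `a`. -/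
def recursionCode (k : ℕ) : Submodule (ZMod 2) (Fin k → ZMod 2) where
  carrier := {v | ∀ j : ℕ, ∀ hj : j + r < k,
    v ⟨j + r, hj⟩ = ∑ i : Fin r, a i * v ⟨j + (i : ℕ), by have := i.isLt; omega⟩}
  add_mem' hv hw j hj := by
    simp only [Pi.add_apply, mul_add, Finset.sum_add_distrib, hv j hj, hw j hj]
  zero_mem' j hj := by simp
  smul_mem' c v hv j hj := by
    simp only [Pi.smul_apply, smul_eq_mul, hv j hj, Finset.mul_sum, mul_left_comm]

theorem finrank_recursionCode_le (hrk : r ≤ k) :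
    Module.finrank (ZMod 2) (recursionCode a k) ≤ r := by
  let R : recursionCode a k →ₗ[ZMod 2] (Fin r → ZMod 2) :=
    (LinearMap.funLeft (ZMod 2) (ZMod 2) (Fin.castLE hrk)).comp (recursionCode a k).subtype
  have hR : Function.Injective R := by
    rw [injective_iff_map_eq_zero]
    rintro ⟨v, hv⟩ h
    have hlt : ∀ i : Fin r, v (Fin.castLE hrk i) = 0 := fun i => congrFun h i
    have : ∀ m : ℕ, ∀ hm : m < k, v ⟨m, hm⟩ = 0 := by
      intro m
      induction m using Nat.strong_induction_on with
      | _ m ih =>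
        intro hm
        rcases lt_or_ge m r with hmr | hmr
        · exact hlt ⟨m, hmr⟩
        · obtain ⟨j, rfl⟩ := Nat.exists_eq_add_of_le' hmr
          rw [hv j hm]
          exact Finset.sum_eq_zero fun i _ => by rw [ih _ (by omega), mul_zero]
    exact Subtype.ext (funext fun i => this i i.isLt)
  simpa using LinearMap.finrank_le_finrank_of_injective hR

theorem root_pow_add (j : ℕ) :
    AdjoinRoot.root (lfsrPoly a) ^ (j + r) =
      ∑ i : Fin r, a i • AdjoinRoot.root (lfsrPoly a) ^ (j + (i : ℕ)) := by
  have h : aeval (AdjoinRoot.root (lfsrPoly a)) (X ^ r + ∑ i : Fin r, C (a i) * X ^ (i : ℕ)) = 0 :=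
    (AdjoinRoot.aeval_eq (lfsrPoly a)).trans AdjoinRoot.mk_self
  rw [map_add, map_pow, aeval_X, map_sum, add_eq_zero_iff_eq_neg, ZModModule.neg_eq_self] at h
  rw [pow_add, h, Finset.mul_sum]
  refine Finset.sum_congr rfl fun i _ => ?_
  rw [map_mul, aeval_C, map_pow, aeval_X, ← Algebra.smul_def, mul_smul_comm, pow_add]

variable {a}

/-- The word whose `i`-th letter is the value of the functional `l` at `y * z ^ i`,
for `z` the adjoined root. -/
noncomputable def traceWord (l : AdjoinRoot (lfsrPoly a) →ₗ[ZMod 2] ZMod 2) (k : ℕ) :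
    AdjoinRoot (lfsrPoly a) →ₗ[ZMod 2] (Fin k → ZMod 2) :=
  LinearMap.pi fun i =>
    l ∘ₗ LinearMap.mulRight (ZMod 2) (AdjoinRoot.root (lfsrPoly a) ^ (i : ℕ))

theorem traceWord_apply (l : AdjoinRoot (lfsrPoly a) →ₗ[ZMod 2] ZMod 2)
    (y : AdjoinRoot (lfsrPoly a)) (i : Fin k) :
    traceWord l k y i = l (y * AdjoinRoot.root (lfsrPoly a) ^ (i : ℕ)) :=
  rfl

theorem range_traceWord_le (l : AdjoinRoot (lfsrPoly a) →ₗ[ZMod 2] ZMod 2) :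
    LinearMap.range (traceWord l k) ≤ recursionCode a k := by
  rintro _ ⟨y, rfl⟩ j hj
  simp only [traceWord_apply, root_pow_add, Finset.mul_sum, map_sum, mul_smul_comm, map_smul,
    smul_eq_mul]

theorem traceWord_injective (hrk : r ≤ k) (ha : Irreducible (lfsrPoly a))
    {l : AdjoinRoot (lfsrPoly a) →ₗ[ZMod 2] ZMod 2} (hl : l 1 ≠ 0) :
    Function.Injective (traceWord l k) := by
  have : Fact (Irreducible (lfsrPoly a)) := ⟨ha⟩
  rw [injective_iff_map_eq_zero]
  intro y hy
  by_contra hne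
  have hzero : l ∘ₗ LinearMap.mulLeft (ZMod 2) y = 0 := by
    refine (AdjoinRoot.powerBasis (lfsrPoly_ne_zero a)).basis.ext fun i => ?_
    have hi : (i : ℕ) < k := by
      have := i.isLt
      have hdim := AdjoinRoot.powerBasis_dim (lfsrPoly_ne_zero a)
      rw [natDegree_lfsrPoly] at hdim
      omega
    rw [PowerBasis.basis_eq_pow, AdjoinRoot.powerBasis_gen]
    exact congrFun hy ⟨i, hi⟩
  apply hl
  simpa [hne] using LinearMap.congr_fun hzero y⁻¹

theorem range_traceWord_eq (hrk : r ≤ k) (ha : Irreducible (lfsrPoly a))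
    {l : AdjoinRoot (lfsrPoly a) →ₗ[ZMod 2] ZMod 2} (hl : l 1 ≠ 0)
    {D : Submodule (ZMod 2) (Fin k → ZMod 2)} (hD : Module.finrank (ZMod 2) D = r)
    (hle : D ≤ recursionCode a k) : LinearMap.range (traceWord l k) = D := by
  have hfin := finrank_recursionCode_le a hrk
  have hrange : Module.finrank (ZMod 2) (LinearMap.range (traceWord l k)) = r := by
    rw [LinearMap.finrank_range_of_inj (traceWord_injective hrk ha hl),
      (AdjoinRoot.powerBasis (lfsrPoly_ne_zero a)).finrank, AdjoinRoot.powerBasis_dim,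
      natDegree_lfsrPoly]
  rw [Submodule.eq_of_le_of_finrank_le (range_traceWord_le l) (hfin.trans hrange.ge),
    Submodule.eq_of_le_of_finrank_le hle (hfin.trans hD.ge)]

theorem exists_window_sequence (hr : 1 ≤ r) (hrk : r ≤ k) (ha : IsPrimitivePoly a)
    {D : Submodule (ZMod 2) (Fin k → ZMod 2)} (hD : Module.finrank (ZMod 2) D = r)
    (hle : D ≤ recursionCode a k) :
    ∃ x : ZMod (2 ^ r - 1) → ZMod 2,
      Function.Injective (fun m : ZMod (2 ^ r - 1) => win k x m) ∧
      Set.range (fun m : ZMod (2 ^ r - 1) => win k x m) = {v | v ∈ D ∧ v ≠ 0} := by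
  obtain ⟨hirr, hord⟩ := ha
  have : Fact (Irreducible (lfsrPoly a)) := ⟨hirr⟩
  have hr2 : 2 ≤ 2 ^ r := Nat.le_self_pow (by omega) 2
  have : NeZero (2 ^ r - 1) := ⟨by omega⟩
  obtain ⟨l, hl⟩ : ∃ l : AdjoinRoot (lfsrPoly a) →ₗ[ZMod 2] ZMod 2, l 1 ≠ 0 := by
    by_contra! h
    exact one_ne_zero ((Module.forall_dual_apply_eq_zero_iff (ZMod 2) _).1 h)
  have hinj := traceWord_injective hrk hirr hl
  have hroot0 : AdjoinRoot.root (lfsrPoly a) ≠ 0 := by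
    intro h
    rw [h, orderOf_zero] at hord
    omega
  have hroot : ∀ m : ℕ, AdjoinRoot.root (lfsrPoly a) ^ m ≠ 0 := fun m => pow_ne_zero m hroot0
  have hpow : ∀ m m' : ℕ,
      AdjoinRoot.root (lfsrPoly a) ^ m = AdjoinRoot.root (lfsrPoly a) ^ m' ↔
        (m : ZMod (2 ^ r - 1)) = m' := by
    intro m m'
    rw [ZMod.natCast_eq_natCast_iff, ← hord, ← Units.val_mk0 hroot0, orderOf_units,
      ← pow_eq_pow_iff_modEq, Units.ext_iff, Units.val_pow_eq_pow_val, Units.val_pow_eq_pow_val]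
  have hσ := zeroOrPow_injective (n := 2 ^ r - 1) hroot fun m m' => (hpow m m').1
  have hsurj : Function.Surjective (zeroOrPow (2 ^ r - 1) (AdjoinRoot.root (lfsrPoly a))) := by
    obtain ⟨hfin, hcard⟩ := card_adjoinRoot (lfsrPoly_ne_zero a)
    refine ((Nat.bijective_iff_injective_and_card _).2 ⟨hσ, ?_⟩).2
    rw [hcard, natDegree_lfsrPoly, Finite.card_option, Nat.card_zmod]
    omega
  have hwin : ∀ m : ZMod (2 ^ r - 1),
      win k (fun m => l (AdjoinRoot.root (lfsrPoly a) ^ m.val)) m =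
        traceWord l k (AdjoinRoot.root (lfsrPoly a) ^ m.val) := by
    intro m
    funext i
    rw [traceWord_apply, ← pow_add, win]
    congr 1
    rw [hpow]
    simp
  refine ⟨fun m => l (AdjoinRoot.root (lfsrPoly a) ^ m.val), fun m m' h => ?_, ?_⟩
  · simp only [hwin] at h
    simpa using (hpow _ _).1 (hinj h)
  · simp only [hwin, ← range_traceWord_eq hrk hirr hl hD hle]
    ext v
    constructor
    · rintro ⟨m, rfl⟩
      exact ⟨⟨_, rfl⟩, fun h => hroot _ (hinj (h.trans (map_zero _).symm))⟩
    · rintro ⟨⟨y, rfl⟩, hy⟩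
      obtain ⟨_ | m, rfl⟩ := hsurj y
      · exact absurd (map_zero _) hy
      · exact ⟨m, rfl⟩

end Recursion

theorem stmt4 (r k : ℕ) (hr : 1 ≤ r) (hrk : r ≤ k)
    (C : Submodule (ZMod 2) (Fin k → ZMod 2))
    (hdim : Module.finrank (ZMod 2) C = r)
    (G : Matrix (Fin r) (Fin k) (ZMod 2))
    (hG : Submodule.span (ZMod 2) (Set.range fun s : Fin r => G s) = C) :
    (∃ x : ZMod (2 ^ r - 1) → ZMod 2,
        Function.Injective (fun m : ZMod (2 ^ r - 1) => win k x m) ∧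
        Set.range (fun m : ZMod (2 ^ r - 1) => win k x m) = {v | v ∈ C ∧ v ≠ 0}) ↔
    ((∀ j : ℕ, ∀ hj : j + r ≤ k, LinearIndependent (ZMod 2)
        (fun i : Fin r => fun s : Fin r => G s ⟨j + (i : ℕ), by have := i.isLt; omega⟩)) ∧
      ∃ a : Fin r → ZMod 2, IsPrimitivePoly a ∧
        ∀ j : ℕ, ∀ hj : j + r < k,
          (fun s : Fin r => G s ⟨j + r, hj⟩) =
            ∑ i : Fin r, a i • (fun s : Fin r => G s ⟨j + (i : ℕ), by have := i.isLt; omega⟩)) := by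
  have hrow : ∀ s, G s ∈ C := fun s => hG ▸ Submodule.subset_span ⟨s, rfl⟩
  constructor
  · rintro ⟨x, hinj, hrange⟩
    have hr2 : 2 ≤ 2 ^ r := Nat.le_self_pow (by omega) 2
    have : NeZero (2 ^ r - 1) := ⟨by omega⟩
    have hwin : ∀ m, win k x m ∈ C ∧ win k x m ≠ 0 := fun m =>
      hrange.subset ⟨m, rfl⟩
    have hx : x ≠ 0 := by
      rintro rfl
      exact (hwin 0).2 rfl
    have hshift : Function.Injective fun m j : ZMod (2 ^ r - 1) => x (j + m) := by
      intro m m' h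
      refine hinj (funext fun i => ?_)
      simpa [win, add_comm] using congrFun h ((i : ℕ) : ZMod (2 ^ r - 1))
    have hC : ∀ φ : (Fin k → ZMod 2) →ₗ[ZMod 2] ZMod 2, (∀ s, φ (G s) = 0) →
        ∀ m, φ (win k x m) = 0 := by
      intro φ hφ m
      have hle : C ≤ LinearMap.ker φ := by
        rw [← hG, Submodule.span_le]
        rintro _ ⟨s, rfl⟩
        exact hφ s
      exact hle (hwin m).1
    have hind : ∀ j : ℕ, ∀ hj : j + r ≤ k, LinearIndependent (ZMod 2)
        (fun i : Fin r => fun s : Fin r => G s ⟨j + (i : ℕ), by have := i.isLt; omega⟩) := by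
      intro j hj
      rw [Fintype.linearIndependent_iff]
      intro c hc
      have hlt : ∀ i : Fin r, j + (i : ℕ) < k := fun i => by omega
      have hq : aeval (cyclicShift _) (∑ i : Fin r, Polynomial.C (c i) * X ^ (i : ℕ)) x = 0 := by
        funext t
        have := hC (∑ i : Fin r, c i • LinearMap.proj ⟨j + (i : ℕ), hlt i⟩)
          (fun s => by simpa [LinearMap.sum_apply] using congrFun hc s) (t - j)
        rw [aeval_cyclicShift_sum_apply]
        simpa [LinearMap.sum_apply, win, ← add_assoc] using this
      by_contra! hne
      obtain ⟨i, hi⟩ := hne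
      have hq0 : (∑ i : Fin r, Polynomial.C (c i) * X ^ (i : ℕ) : (ZMod 2)[X]) ≠ 0 := by
        intro h0
        have := congrArg (fun q => Polynomial.coeff q i) h0
        simp [Polynomial.finsetSum_coeff, Polynomial.coeff_X_pow, Fin.val_inj, hi] at this
      have hle := succ_le_two_pow_natDegree hx hshift hq0 hq
      have hdeg := (natDegree_lt_iff_degree_lt hq0).2 (degree_sum_C_mul_X_pow_lt c)
      have := Nat.pow_lt_pow_right (a := 2) (by omega) hdeg
      omega
    refine ⟨hind, ?_⟩
    rcases hrk.eq_or_lt with rfl | hlt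
    · obtain ⟨a, ha⟩ := exists_isPrimitivePoly (r := r) (by omega)
      exact ⟨a, ha, fun j hj => by omega⟩
    · have htop := (hind 0 (by omega)).span_eq_top_of_card_eq_finrank' (by simp)
      obtain ⟨a, ha⟩ := (Submodule.mem_span_range_iff_exists_fun (ZMod 2)).1
        (htop.ge (Submodule.mem_top (x := fun s => G s ⟨r, hlt⟩)))
      have hrec : IsLFSR a x := by
        intro m
        have := hC (LinearMap.proj ⟨r, hlt⟩ -
          ∑ i : Fin r, a i • LinearMap.proj (Fin.castLE hrk i))
          (fun s => by simpa [LinearMap.sum_apply, sub_eq_zero, Fin.castLE] using (congrFun ha s).symm) m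
        simpa [LinearMap.sum_apply, win, sub_eq_zero] using this
      refine ⟨a, isPrimitivePoly_of_isLFSR rfl hx hshift hrec, fun j hj => funext fun s => ?_⟩
      rw [Finset.sum_apply]
      simp only [Pi.smul_apply, smul_eq_mul]
      by_cases h0 : G s = 0
      · simp [h0]
      · obtain ⟨m, hm⟩ := hrange.superset ⟨hrow s, h0⟩
        rw [← hm]
        simpa [win, add_assoc] using hrec (m + j)
  · rintro ⟨-, a, ha, hrec⟩
    refine exists_window_sequence hr hrk ha hdim ?_
    rw [← hG, Submodule.span_le]
    rintro _ ⟨s, rfl⟩ j hj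
    simpa [Finset.sum_apply] using congrFun (hrec j hj) s
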